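/- Fix a prime number p and integers d, f ≥ 1, and let k be a field of characteristic zero. Consider 2f matrices of indeterminates X⁽⁰⁾,…,X⁽ᶠ⁻¹⁾ and Y⁽⁰⁾,…,Y⁽ᶠ⁻¹⁾, each of size d×d. Let A be the localization of the polynomial ring over k in these 2fd² variables at the element det(X⁽⁰⁾)·det(X⁽¹⁾)⋯det(X⁽ᶠ⁻¹⁾), and let I ⊆ A be the ideal generated by the f·d² entries of the matrices p·X⁽ⁱ⁾·Y⁽ⁱ⁻¹⁾ − Y⁽ⁱ⁾·X⁽ⁱ⁾ for i = 0,…,f−1 (superscripts taken modulo f). Then the Krull dimension of the ring A/I equals f·d². -/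

import Mathlib

noncomputable section

variable (k : Type) [Field k] (p d f : ℕ)

/-- The polynomial ring over `k` in the `2·f·d²` entries of the matrices
`X⁽⁰⁾,…,X⁽ᶠ⁻¹⁾, Y⁽⁰⁾,…,Y⁽ᶠ⁻¹⁾`. -/
abbrev PKPoly := MvPolynomial (Fin 2 × Fin f × Fin d × Fin d) k

/-- The matrix of indeterminates `X⁽ⁱ⁾`. -/
def Xmat (i : Fin f) : Matrix (Fin d) (Fin d) (PKPoly k d f) :=
  Matrix.of fun a b => MvPolynomial.X (0, i, a, b)

/-- The matrix of indeterminates `Y⁽ⁱ⁾`. -/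
def Ymat (i : Fin f) : Matrix (Fin d) (Fin d) (PKPoly k d f) :=
  Matrix.of fun a b => MvPolynomial.X (1, i, a, b)

/-- The element `det(X⁽⁰⁾)·det(X⁽¹⁾)⋯det(X⁽ᶠ⁻¹⁾)`. -/
def detProd : PKPoly k d f := ∏ i : Fin f, (Xmat k d f i).det

/-- The localization `A` of the polynomial ring at `det(X⁽⁰⁾)⋯det(X⁽ᶠ⁻¹⁾)`. -/
abbrev PKLoc := Localization.Away (detProd k d f)

def XmatL (i : Fin f) : Matrix (Fin d) (Fin d) (PKLoc k d f) :=
  (Xmat k d f i).map (algebraMap (PKPoly k d f) (PKLoc k d f))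

def YmatL (i : Fin f) : Matrix (Fin d) (Fin d) (PKLoc k d f) :=
  (Ymat k d f i).map (algebraMap (PKPoly k d f) (PKLoc k d f))

/-- The ideal `I ⊆ A` generated by the `f·d²` entries of the matrices
`p·X⁽ⁱ⁾·Y⁽ⁱ⁻¹⁾ − Y⁽ⁱ⁾·X⁽ⁱ⁾`, `i = 0,…,f−1` (superscripts mod `f`). -/
def relIdeal [NeZero f] : Ideal (PKLoc k d f) :=
  Ideal.span {x | ∃ (i : Fin f) (a b : Fin d),
    x = ((p : PKLoc k d f) • (XmatL k d f i * YmatL k d f (i - 1)) -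
          YmatL k d f i * XmatL k d f i) a b}

open Polynomial in
theorem Matrix.charpoly_smul_coeff_mul_pow {R n : Type*} [CommRing R] [Fintype n] [DecidableEq n]
    (c : R) (N : Matrix n n R) (j : ℕ) :
    (c • N).charpoly.coeff j * c ^ j = c ^ Fintype.card n * N.charpoly.coeff j := by
  have h : (c • N).charpoly.comp (C c * X) = C (c ^ Fintype.card n) * N.charpoly := by
    change Polynomial.compRingHom (C c * X) (c • N).charpoly = _
    rw [Matrix.charpoly, RingHom.map_det, Matrix.charpoly, C_pow, ← Matrix.det_smul]
    congr 1
    ext1 a b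
    by_cases hab : a = b
    · subst hab
      simp [mul_sub]
    · simp [Matrix.charmatrix_apply_ne _ _ _ hab]
  simpa only [comp_C_mul_X_coeff, coeff_C_mul] using congrArg (fun q => q.coeff j) h

theorem Matrix.isNilpotent_of_cyclic_semiconj {L : Type*} [Field L] [CharZero L] {f : ℕ} [NeZero f]
    {n : Type*} [Fintype n] [DecidableEq n] {p : ℕ} (hp : 1 < p) (X N : Fin f → Matrix n n L)
    (hX : ∀ i, IsUnit (X i)) (h : ∀ i, (p : L) • (X i * N (i - 1)) = N i * X i) (i : Fin f) :
    IsNilpotent (N i) := by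
  have hc (i) : (N i).charpoly = ((p : L) • N (i - 1)).charpoly := by
    obtain ⟨u, hu⟩ := hX i
    have : N i = u.val * ((p : L) • N (i - 1)) * (u⁻¹).val := by
      rw [Matrix.mul_smul, hu, h, ← hu, mul_assoc, Units.mul_inv, mul_one]
    rw [this, Matrix.charpoly_mul_comm, ← mul_assoc, Units.inv_mul, one_mul]
  have hp0 : (p : L) ≠ 0 := by exact_mod_cast (by omega : p ≠ 0)
  have step (j m : ℕ) (hm : m + j = Fintype.card n) (i) :
      (N i).charpoly.coeff j = (p : L) ^ m * (N (i - 1)).charpoly.coeff j := by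
    have := Matrix.charpoly_smul_coeff_mul_pow (p : L) (N (i - 1)) j
    rw [← hc, ← hm, pow_add] at this
    apply mul_right_cancel₀ (pow_ne_zero j hp0)
    rw [this]; ring
  have iter (j m : ℕ) (hm : m + j = Fintype.card n) (i) (r : ℕ) :
      (N i).charpoly.coeff j = ((p : L) ^ m) ^ r * (N (i - Fin.ofNat f r)).charpoly.coeff j := by
    induction r with
    | zero => simp
    | succ r ih =>
      rw [ih, step j m hm (i - Fin.ofNat f r), pow_succ, mul_assoc]
      have : i - Fin.ofNat f r - 1 = i - Fin.ofNat f (r + 1) := by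
        rw [sub_sub]; congr 1
        ext; simp [Fin.val_add]
      rw [this]
  have hzero (j : ℕ) (hj : j < Fintype.card n) : (N i).charpoly.coeff j = 0 := by
    have := iter j (Fintype.card n - j) (by omega) i f
    have h0 : Fin.ofNat f f = 0 := by ext; simp
    rw [h0, sub_zero, ← pow_mul] at this
    have hne : (p : L) ^ ((Fintype.card n - j) * f) ≠ 1 := by
      have : 1 < p ^ ((Fintype.card n - j) * f) :=
        Nat.one_lt_pow (Nat.mul_ne_zero (by omega) (NeZero.ne f)) hp
      exact_mod_cast this.ne'
    by_contra hne0
    exact hne (mul_right_cancel₀ hne0 (by rw [← this, one_mul]))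
  have hX' : (N i).charpoly = Polynomial.X ^ Fintype.card n := by
    ext j
    rw [Polynomial.coeff_X_pow]
    split_ifs with hj
    · have := (N i).charpoly_monic.coeff_natDegree
      rwa [Matrix.charpoly_natDegree_eq_dim, ← hj] at this
    · rcases lt_or_gt_of_ne hj with hj | hj
      · exact hzero j hj
      · exact Polynomial.coeff_eq_zero_of_natDegree_lt (by rwa [Matrix.charpoly_natDegree_eq_dim])
  refine ⟨Fintype.card n, ?_⟩
  simpa [hX'] using Matrix.aeval_self_charpoly (N i)

section

open Polynomial Matrix

theorem Derivation.exists_addMonoidHom_polynomial {R A : Type*} [CommRing R] [CommRing A]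
    [Algebra R A] (δ : Derivation R A A) :
    ∃ D : A[X] →+ A[X], (∀ q r, D (q * r) = D q * r + q * D r) ∧ D X = 0 ∧
      ∀ a, D (C a) = C (δ a) := by
  let _ : Differential A := ⟨δ.restrictScalars ℤ⟩
  refine ⟨(Differential.mapCoeffs (A := A)).toLinearMap.toAddMonoidHom, fun q r => ?_, ?_, ?_⟩
  · change Differential.mapCoeffs (q * r) = _
    rw [Derivation.leibniz]
    simp only [smul_eq_mul]
    rw [add_comm, mul_comm r]
    rfl
  · exact Differential.mapCoeffs_X
  · intro a
    exact Differential.mapCoeffs_C a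

/-- An additive `D`-connection. -/
def HasConnection {A : Type*} [CommRing A] (D : A →+ A) (M : Type*)
    [AddCommGroup M] [Module A M] : Prop :=
  ∃ E : M →+ M, ∀ (a : A) (m : M), E (a • m) = D a • m + a • E m

namespace HasConnection
variable {A : Type*} [CommRing A] {D : A →+ A}

theorem of_linearEquiv {M M' : Type*} [AddCommGroup M] [Module A M] [AddCommGroup M'] [Module A M']
    (e : M ≃ₗ[A] M') (h : HasConnection D M') : HasConnection D M := by
  obtain ⟨E, hE⟩ := h
  refine ⟨e.symm.toLinearMap.toAddMonoidHom.comp (E.comp e.toLinearMap.toAddMonoidHom),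
    fun a m => ?_⟩
  simp [hE]

theorem pi {ι : Type*} {M : ι → Type*} [∀ i, AddCommGroup (M i)] [∀ i, Module A (M i)]
    (h : ∀ i, HasConnection D (M i)) : HasConnection D (∀ i, M i) := by
  choose E hE using h
  refine ⟨AddMonoidHom.pi fun i => (E i).comp (Pi.evalAddMonoidHom M i), fun a m => ?_⟩
  ext i
  exact hE i a (m i)

theorem quotient_span_singleton (hD : ∀ a b, D (a * b) = D a * b + a * D b) {x : A}
    (hx : D x = 0) : HasConnection D (A ⧸ Ideal.span {x}) := by
  refine ⟨QuotientAddGroup.map _ _ D ?_, fun a m => ?_⟩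
  · intro y hy
    obtain ⟨z, rfl⟩ := Ideal.mem_span_singleton'.1 (show y ∈ Ideal.span {x} from hy)
    change D (z * x) ∈ Ideal.span {x}
    rw [hD, hx, mul_zero, add_zero]
    exact Ideal.mul_mem_left _ _ (Ideal.mem_span_singleton_self x)
  · obtain ⟨m, rfl⟩ := Ideal.Quotient.mk_surjective m
    change Ideal.Quotient.mk (Ideal.span {x}) (D (a * m)) =
      Ideal.Quotient.mk (Ideal.span {x}) (D a * m + a * D m)
    rw [hD]

end HasConnection

theorem Matrix.exists_map_derivation_eq_commutator {k L : Type*} [CommRing k] [Field L] [Algebra k L]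
    (δ : Derivation k L L) {n : Type*} [Fintype n] [DecidableEq n] (N : Matrix n n L)
    (hN : IsNilpotent N) : ∃ G : Matrix n n L, N.map δ = N * G - G * N := by
  classical
  obtain ⟨D, hD, hDX, hDC⟩ := δ.exists_addMonoidHom_polynomial
  let φ : Module.End L (n → L) := Matrix.toLin' N
  have hφ : IsNilpotent φ := (IsNilpotent.map hN (Matrix.toLinAlgEquiv' (R := L) (n := n)))
  have htors : Module.IsTorsion' (Module.AEval' φ) (Submonoid.powers (X : L[X])) := by
    obtain ⟨r, hr⟩ := hφ
    intro m
    refine ⟨⟨X ^ r, r, rfl⟩, ?_⟩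
    obtain ⟨v, rfl⟩ := (Module.AEval'.of φ).surjective m
    change (X ^ r : L[X]) • Module.AEval'.of φ v = 0
    rw [Module.AEval'.X_pow_smul_of, hr]
    simp
  have : Module.Finite L[X] (Module.AEval' φ) := inferInstance
  obtain ⟨s, e, ⟨E⟩⟩ := Module.torsion_by_prime_power_decomposition (p := (X : L[X]))
    (Polynomial.irreducible_X) htors
  have hconn : HasConnection D (Module.AEval' φ) := by
    refine .of_linearEquiv (E.trans (DirectSum.linearEquivFunOnFintype _ _ _)) (.pi fun i => ?_)
    refine HasConnection.quotient_span_singleton hD ?_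
    induction e i with
    | zero => simpa using hD 1 1
    | succ r ih => rw [pow_succ, hD, ih, hDX, zero_mul, mul_zero, add_zero]
  obtain ⟨T, hT⟩ := hconn
  let T' : (n → L) → (n → L) := fun v => (Module.AEval'.of φ).symm (T (Module.AEval'.of φ v))
  have hadd (v w) : T' (v + w) = T' v + T' w := by simp [T']
  have hsmul (a : L) (v) : T' (a • v) = δ a • v + a • T' v := by
    apply (Module.AEval'.of φ).injective
    have := hT (C a) (Module.AEval'.of φ v)
    rw [hDC] at this
    simpa [T', Module.AEval.C_smul] using this
  have hcomm (v) : T' (N *ᵥ v) = N *ᵥ T' v := by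
    apply (Module.AEval'.of φ).injective
    have := hT X (Module.AEval'.of φ v)
    rw [hDX, zero_smul, zero_add, Module.AEval'.X_smul_of] at this
    simp only [T', LinearEquiv.apply_symm_apply]
    obtain ⟨w, hw⟩ := (Module.AEval'.of φ).surjective (T (Module.AEval'.of φ v))
    rw [← hw, Module.AEval'.X_smul_of] at this
    rw [← hw]
    simpa [φ] using this
  have hsum (v : n → L) : T' v = (fun i => δ (v i)) +
      (Matrix.of fun i j => T' (Pi.single j 1) i) *ᵥ v := by
    have h1 (t : Finset n) : T' (∑ j ∈ t, v j • Pi.single j 1) =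
        ∑ j ∈ t, (δ (v j) • Pi.single j (1 : L) + v j • T' (Pi.single j 1)) := by
      induction t using Finset.induction_on with
      | empty => simp [T']
      | insert j t hj ih => rw [Finset.sum_insert hj, Finset.sum_insert hj, hadd, ih, hsmul]
    have h2 (w : n → L) : w = ∑ j, w j • Pi.single j (1 : L) := by
      ext i; simp [Pi.single_apply]
    conv_lhs => rw [h2 v, h1, Finset.sum_add_distrib, ← h2 (fun j => δ (v j))]
    congr 1
    ext i
    simp [Matrix.mulVec, dotProduct, mul_comm]
  refine ⟨Matrix.of fun i j => T' (Pi.single j 1) i, ?_⟩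
  ext i j
  have := congrFun (hcomm (Pi.single j 1)) i
  rw [hsum, Matrix.mulVec_single_one] at this
  rw [Matrix.sub_apply, eq_sub_iff_add_eq]
  simpa [Matrix.mul_apply, Matrix.mulVec, dotProduct] using this

end

/-- Entrywise evaluation of derivations on a fixed matrix. -/
def Derivation.matrixEval (k : Type*) {L n : Type*} [CommRing k] [Field L] [Algebra k L]
    (M : Matrix n n L) : Derivation k L L →ₗ[L] Matrix n n L where
  toFun δ := M.map δ
  map_add' _ _ := rfl
  map_smul' _ _ := rfl

theorem Derivation.matrix_map_mul {k L n : Type*} [CommRing k] [Field L] [Algebra k L] [Fintype n]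
    (δ : Derivation k L L) (M N : Matrix n n L) :
    (M * N).map δ = M.map δ * N + M * N.map δ := by
  ext a b
  simp [Matrix.mul_apply, ← Finset.sum_add_distrib, mul_comm, add_comm]

/-- The commutator `G ↦ N * G - G * N`. -/
def Matrix.adLinear {L n : Type*} [Field L] [Fintype n] (N : Matrix n n L) :
    Matrix n n L →ₗ[L] Matrix n n L :=
  LinearMap.mulLeft L N - LinearMap.mulRight L N

theorem Derivation.finrank_le_of_cyclic_semiconj {k L : Type*} [Field k] [Field L] [Algebra k L]
    [CharZero L] {f : ℕ} [NeZero f] {n : Type*} [Fintype n] [DecidableEq n] {p : ℕ} (hp : 1 < p)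
    (X N : Fin f → Matrix n n L)
    (hX : ∀ i, IsUnit (X i)) (h : ∀ i, (p : L) • (X i * N (i - 1)) = N i * X i)
    (hgen : ∀ δ : Derivation k L L, (∀ i, (X i).map δ = 0) → (∀ i, (N i).map δ = 0) → δ = 0) :
    Module.finrank L (Derivation k L L) ≤ f * Fintype.card n ^ 2 := by
  have hp0 : (p : L) ≠ 0 := by exact_mod_cast (by omega : p ≠ 0)
  have : Module.Finite L (Derivation k L L) := by
    refine Module.Finite.of_injective ((LinearMap.pi fun i => matrixEval k (X i)).prod
      (LinearMap.pi fun i => matrixEval k (N i))) ?_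
    rw [← LinearMap.ker_eq_bot, LinearMap.ker_eq_bot']
    intro δ hδ
    have h1 := congrArg Prod.fst hδ
    have h2 := congrArg Prod.snd hδ
    exact hgen δ (fun i => congrFun h1 i) (fun i => congrFun h2 i)
  let φ : Derivation k L L →ₗ[L] ∀ i, LinearMap.range (Matrix.adLinear (N i)) :=
    LinearMap.pi fun i => (matrixEval k (N i)).codRestrict _ fun δ => by
      obtain ⟨G, hG⟩ := Matrix.exists_map_derivation_eq_commutator δ (N i)
        (Matrix.isNilpotent_of_cyclic_semiconj hp X N hX h i)
      exact ⟨G, hG.symm⟩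
  have hφ (δ : Derivation k L L) (hδ : φ δ = 0) (i) : (N i).map δ = 0 :=
    congrArg Subtype.val (congrFun hδ i)
  have hmem (δ : Derivation k L L) (hδ : φ δ = 0) (i) :
      (X i)⁻¹ * (X i).map δ ∈ LinearMap.ker (Matrix.adLinear (N (i - 1))) := by
    have hdet := (Matrix.isUnit_iff_isUnit_det _).1 (hX i)
    have h1 := congrArg (fun M => M.map δ) (h i)
    have h2 : ((p : L) • (X i * N (i - 1))).map δ = (p : L) • (X i * N (i - 1)).map δ := by
      ext a b
      simp
    simp only [h2, matrix_map_mul, hφ δ hδ, mul_zero, zero_mul, add_zero, zero_add] at h1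
    have h3 : (X i).map δ = X i * ((X i)⁻¹ * (X i).map δ) := by
      rw [← mul_assoc, Matrix.mul_nonsing_inv _ hdet, one_mul]
    set Z := (X i)⁻¹ * (X i).map δ
    rw [h3, ← mul_assoc (N i), ← h i, Matrix.smul_mul] at h1
    have h4 := smul_right_injective _ hp0 h1
    simp only [mul_assoc] at h4
    have h5 := (hX i).mul_right_injective h4
    rw [LinearMap.mem_ker]
    change N (i - 1) * Z - Z * N (i - 1) = 0
    rw [h5, sub_self]
  let ψ : LinearMap.ker φ →ₗ[L] ∀ i : Fin f, LinearMap.ker (Matrix.adLinear (N (i - 1))) :=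
    LinearMap.pi fun i => ((LinearMap.mulLeft L (X i)⁻¹ ∘ₗ matrixEval k (X i)) ∘ₗ
      (LinearMap.ker φ).subtype).codRestrict _ fun δ => hmem δ.1 δ.2 i
  have hψ : Function.Injective ψ := by
    rw [← LinearMap.ker_eq_bot, LinearMap.ker_eq_bot']
    intro δ hδ
    apply Subtype.ext
    refine hgen δ.1 (fun i => ?_) (hφ δ.1 δ.2)
    have h1 : (X i)⁻¹ * (X i).map δ.1 = 0 := congrArg Subtype.val (congrFun hδ i)
    have hdet := (Matrix.isUnit_iff_isUnit_det _).1 (hX i)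
    rw [← one_mul ((X i).map δ.1), ← Matrix.mul_nonsing_inv _ hdet, mul_assoc, h1, mul_zero]
  have e1 : Module.finrank L (LinearMap.range φ) ≤
      ∑ i, Module.finrank L (LinearMap.range (Matrix.adLinear (N i))) :=
    (Submodule.finrank_le _).trans_eq (Module.finrank_pi_fintype L)
  have e2 : Module.finrank L (LinearMap.ker φ) ≤
      ∑ i, Module.finrank L (LinearMap.ker (Matrix.adLinear (N i))) := by
    refine (LinearMap.finrank_le_finrank_of_injective hψ).trans_eq ?_
    rw [Module.finrank_pi_fintype]
    exact (Equiv.subRight (1 : Fin f)).sum_comp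
      fun i => Module.finrank L (LinearMap.ker (Matrix.adLinear (N i)))
  calc Module.finrank L (Derivation k L L)
      = Module.finrank L (LinearMap.range φ) + Module.finrank L (LinearMap.ker φ) :=
        (LinearMap.finrank_range_add_finrank_ker φ).symm
    _ ≤ ∑ i, (Module.finrank L (LinearMap.range (Matrix.adLinear (N i))) +
          Module.finrank L (LinearMap.ker (Matrix.adLinear (N i)))) := by
        rw [Finset.sum_add_distrib]; exact add_le_add e1 e2
    _ = f * Fintype.card n ^ 2 := by
        simp [LinearMap.finrank_range_add_finrank_ker, Module.finrank_matrix, sq]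

theorem ringKrullDim_eq_of_injective_of_isIntegral {R S : Type*} [CommRing R] [CommRing S]
    [Algebra R S] [Algebra.IsIntegral R S] (h : Function.Injective (algebraMap R S)) :
    ringKrullDim S = ringKrullDim R := by
  apply le_antisymm
  · refine Order.krullDim_le_of_strictMono (PrimeSpectrum.comap (algebraMap R S)) fun P Q hPQ => ?_
    exact Ideal.IsIntegral.comap_lt_comap (show P.asIdeal < Q.asIdeal from hPQ)
  · refine iSup_le fun l => ?_
    obtain ⟨P, hP, hPl⟩ := Ideal.exists_ideal_over_prime_of_isIntegral l.head.asIdeal (⊥ : Ideal S)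
      (by simp [Ideal.comap_bot_of_injective _ h])
    obtain ⟨hP', hPl⟩ := hPl
    have : P.LiesOver l.head.asIdeal := ⟨hPl.symm⟩
    obtain ⟨l', hl', -, -⟩ := Ideal.exists_ltSeries_of_hasGoingUp l P
    rw [← hl']
    exact le_iSup (fun l : LTSeries (PrimeSpectrum S) => (l.length : WithBot ℕ∞)) l'

open KaehlerDifferential in
theorem finrank_derivation_eq_of_finite_injective {k B L : Type} [Field k] [CharZero k] [CommRing B]
    [IsDomain B] [Algebra k B] [Field L] [Algebra B L] [IsFractionRing B L] [Algebra k L]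
    [IsScalarTower k B L] {m : ℕ} (g : MvPolynomial (Fin m) k →ₐ[k] B) (hg : Function.Injective g)
    (hfin : g.Finite) :
    Module.finrank L (Derivation k L L) = m := by
  let S := MvPolynomial (Fin m) k
  let K := FractionRing S
  let _ : Algebra S B := g.toRingHom.toAlgebra
  have : IsScalarTower k S B := IsScalarTower.of_algebraMap_eq fun x => (g.commutes x).symm
  let _ : Algebra S L := ((algebraMap B L).comp (algebraMap S B)).toAlgebra
  have : IsScalarTower S B L := IsScalarTower.of_algebraMap_eq fun x => rfl
  have : IsScalarTower k S L := IsScalarTower.of_algebraMap_eq fun x => by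
    rw [IsScalarTower.algebraMap_apply S B L, ← IsScalarTower.algebraMap_apply k S B,
      ← IsScalarTower.algebraMap_apply k B L]
  have hinj : Function.Injective (algebraMap S L) :=
    (IsFractionRing.injective B L).comp hg
  have : FaithfulSMul S L := (faithfulSMul_iff_algebraMap_injective S L).2 hinj
  have : FaithfulSMul S B := (faithfulSMul_iff_algebraMap_injective S B).2 hg
  let _ : Algebra K L := FractionRing.liftAlgebra S L
  have : IsScalarTower S K L := inferInstance
  have : Module.Finite S B := hfin
  have : Algebra.IsAlgebraic S L := (IsFractionRing.isAlgebraic_iff' S B L).1 inferInstance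
  have : Algebra.IsAlgebraic K L :=
    (IsFractionRing.comap_isAlgebraic_iff (A := S) (K := K) (C := L)).1 inferInstance
  have : CharZero K := charZero_of_injective_algebraMap (algebraMap k K).injective
  have : Algebra.FormallyEtale K L := Algebra.FormallyEtale.of_isSeparable K L
  have : Algebra.FormallyEtale S K := Algebra.FormallyEtale.of_isLocalization (nonZeroDivisors S)
  have : Algebra.FormallyEtale S L := Algebra.FormallyEtale.comp S K L
  have e := tensorKaehlerEquivOfFormallyEtale k S L
  have b := (mvPolynomialBasis k (Fin m)).baseChange L
  have : Module.Free L (Ω[L⁄k]) := Module.Free.of_basis (b.map e)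
  have : Module.Finite L (Ω[L⁄k]) := Module.Finite.of_basis (b.map e)
  rw [← (linearMapEquivDerivation k L).finrank_eq, Module.finrank_linearMap_self,
    Module.finrank_eq_card_basis (b.map e), Fintype.card_fin]

theorem ringKrullDim_eq_of_finite_injective {k B : Type*} [Field k] [CommRing B] [Algebra k B]
    {m : ℕ} (g : MvPolynomial (Fin m) k →ₐ[k] B) (hg : Function.Injective g) (hfin : g.Finite) :
    ringKrullDim B = m := by
  let _ : Algebra (MvPolynomial (Fin m) k) B := g.toRingHom.toAlgebra
  have : Module.Finite (MvPolynomial (Fin m) k) B := hfin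
  rw [ringKrullDim_eq_of_injective_of_isIntegral (R := MvPolynomial (Fin m) k) hg]
  simp

theorem ringKrullDim_eq_finrank_derivation (k B L : Type) [Field k] [CharZero k] [CommRing B]
    [IsDomain B] [Algebra k B] [Algebra.FiniteType k B] [Field L] [Algebra B L]
    [IsFractionRing B L] [Algebra k L] [IsScalarTower k B L] :
    ringKrullDim B = Module.finrank L (Derivation k L L) := by
  obtain ⟨m, g, hg, hfin⟩ := exists_finite_inj_algHom_of_fg k B
  rw [ringKrullDim_eq_of_finite_injective g hg hfin,
    finrank_derivation_eq_of_finite_injective (L := L) g hg hfin]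

theorem AlgebraicIndependent.card_le_ringKrullDim {k B ι : Type} [Field k] [CommRing B]
    [IsDomain B] [Algebra k B] [Algebra.FiniteType k B] [Fintype ι] {v : ι → B}
    (hv : AlgebraicIndependent k v) : (Fintype.card ι : WithBot ℕ∞) ≤ ringKrullDim B := by
  obtain ⟨m, g, hg, hfin⟩ := exists_finite_inj_algHom_of_fg k B
  rw [ringKrullDim_eq_of_finite_injective g hg hfin]
  let S := MvPolynomial (Fin m) k
  let _ : Algebra S B := g.toRingHom.toAlgebra
  have : IsScalarTower k S B := IsScalarTower.of_algebraMap_eq fun x => (g.commutes x).symm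
  have : FaithfulSMul S B := (faithfulSMul_iff_algebraMap_injective S B).2 hg
  have : Module.Finite S B := hfin
  have h1 := trdeg_add_eq k S (A := B)
  rw [trdeg_eq_zero (R := S), add_zero, MvPolynomial.trdeg_of_isDomain] at h1
  have h2 := hv.cardinalMk_le_trdeg
  rw [← h1] at h2
  have h3 : Fintype.card ι ≤ m := by simpa using h2
  exact_mod_cast h3

theorem ringKrullDim_quotient_le_of_forall_prime {R : Type*} [CommRing R] (I : Ideal R)
    (n : WithBot ℕ∞) (h : ∀ P : Ideal R, P.IsPrime → I ≤ P → ringKrullDim (R ⧸ P) ≤ n) :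
    ringKrullDim (R ⧸ I) ≤ n := by
  rw [ringKrullDim_quotient]
  rcases isEmpty_or_nonempty (PrimeSpectrum.zeroLocus (I : Set R)) with hI | hI
  · rw [Order.krullDim_eq_bot]
    exact bot_le
  rw [Order.krullDim_eq_iSup_coheight]
  refine iSup_le fun x => ?_
  rw [Order.coheight_eq_krullDim_Ici]
  refine (Order.krullDim_le_of_strictMono (fun y : Set.Ici x =>
    (⟨y.1.1, y.2⟩ : PrimeSpectrum.zeroLocus (x.1.asIdeal : Set R))) fun _ _ hab => hab).trans ?_
  rw [← ringKrullDim_quotient]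
  exact h x.1.asIdeal x.1.isPrime x.2

theorem isUnit_det_XmatL (i : Fin f) : IsUnit (XmatL k d f i).det := by
  have h : algebraMap (PKPoly k d f) (PKLoc k d f) (detProd k d f) =
      ∏ i, (XmatL k d f i).det :=
    (map_prod _ _ _).trans (Finset.prod_congr rfl fun i _ => RingHom.map_det _ _)
  have hu : IsUnit (∏ i, (XmatL k d f i).det) := h ▸ IsLocalization.Away.algebraMap_isUnit _
  exact isUnit_of_dvd_unit (Finset.dvd_prod_of_mem (fun i => (XmatL k d f i).det)
    (Finset.mem_univ i)) hu

instance : Algebra.FiniteType k (PKLoc k d f) :=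
  have : Algebra.FiniteType (PKPoly k d f) (PKLoc k d f) :=
    IsLocalization.finiteType_of_monoid_fg (Submonoid.powers (detProd k d f)) _
  Algebra.FiniteType.trans (S := PKPoly k d f) inferInstance inferInstance

/-- A derivation on a field generated by the image of `PKLoc` is determined by its values on the
coordinates. -/
theorem derivation_eq_zero_of_XmatL_YmatL {L : Type} [Field L] [Algebra k L]
    (ρ : PKLoc k d f →ₐ[k] L) (hρ : ∀ x : L, ∃ u v, ρ u / ρ v = x) (δ : Derivation k L L)
    (hX : ∀ i, ((XmatL k d f i).map ρ).map δ = 0) (hY : ∀ i, ((YmatL k d f i).map ρ).map δ = 0) :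
    δ = 0 := by
  have hpoly (q : PKPoly k d f) : δ (ρ (algebraMap _ _ q)) = 0 := by
    induction q using MvPolynomial.induction_on with
    | C a =>
      have : ρ (algebraMap (PKPoly k d f) _ (MvPolynomial.C a)) = algebraMap k L a := by
        rw [← MvPolynomial.algebraMap_eq, ← IsScalarTower.algebraMap_apply, AlgHom.commutes]
      rw [this, Derivation.map_algebraMap]
    | add q r hq hr => rw [map_add, map_add, map_add, hq, hr, add_zero]
    | mul_X q s hq =>
      have : δ (ρ (algebraMap (PKPoly k d f) _ (MvPolynomial.X s))) = 0 := by
        obtain ⟨e, i, a, b⟩ := s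
        fin_cases e
        · exact congrFun (congrFun (hX i) a) b
        · exact congrFun (congrFun (hY i) a) b
      rw [map_mul, map_mul, Derivation.leibniz, hq, this, smul_zero, smul_zero, add_zero]
  have hloc (a : PKLoc k d f) : δ (ρ a) = 0 := by
    obtain ⟨⟨q, s⟩, hs⟩ := IsLocalization.surj (Submonoid.powers (detProd k d f)) a
    have h1 := congrArg (fun x => δ (ρ x)) hs
    simp only [map_mul, Derivation.leibniz, hpoly, smul_eq_mul, mul_zero, zero_add] at h1
    refine (mul_eq_zero.1 h1).resolve_left ?_
    exact ((IsLocalization.map_units (PKLoc k d f) s).map ρ).ne_zero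
  ext x
  obtain ⟨u, v, rfl⟩ := hρ x
  rw [Derivation.leibniz_div, hloc, hloc]
  simp

theorem ringKrullDim_le_of_relIdeal_le_ker [CharZero k] [NeZero f] (hp : 1 < p) {B : Type}
    [CommRing B] [IsDomain B] [Algebra k B] (π : PKLoc k d f →ₐ[k] B)
    (hπ : Function.Surjective π) (hle : relIdeal k p d f ≤ RingHom.ker π) :
    ringKrullDim B ≤ ((f * d ^ 2 : ℕ) : WithBot ℕ∞) := by
  have : Algebra.FiniteType k B := Algebra.FiniteType.of_surjective π hπ
  let L := FractionRing B
  have : CharZero L := charZero_of_injective_algebraMap (algebraMap k L).injective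
  rw [ringKrullDim_eq_finrank_derivation k B L]
  let ρ : PKLoc k d f →ₐ[k] L := (IsScalarTower.toAlgHom k B L).comp π
  have hρ (x : L) : ∃ u v, ρ u / ρ v = x := by
    obtain ⟨u, v, -, rfl⟩ := IsFractionRing.div_surjective (A := B) x
    obtain ⟨u, rfl⟩ := hπ u
    obtain ⟨v, rfl⟩ := hπ v
    exact ⟨u, v, rfl⟩
  have hrel (i : Fin f) : (p : L) • ((XmatL k d f i).map ρ * (YmatL k d f (i - 1)).map ρ) =
      (YmatL k d f i).map ρ * (XmatL k d f i).map ρ := by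
    rw [← Matrix.map_mul, ← Matrix.map_mul]
    ext a b
    have h0 : ρ (((p : PKLoc k d f) • (XmatL k d f i * YmatL k d f (i - 1)) -
        YmatL k d f i * XmatL k d f i) a b) = 0 := by
      have hmem := hle (Ideal.subset_span ⟨i, a, b, rfl⟩)
      rw [RingHom.mem_ker] at hmem
      rw [AlgHom.comp_apply, hmem, map_zero]
    rw [Matrix.sub_apply, map_sub, sub_eq_zero, Matrix.smul_apply, smul_eq_mul, map_mul,
      map_natCast] at h0
    exact h0
  have hunit (i : Fin f) : IsUnit ((XmatL k d f i).map ρ) := by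
    rw [Matrix.isUnit_iff_isUnit_det]
    have := (isUnit_det_XmatL k d f i).map ρ
    rwa [AlgHom.map_det] at this
  have := Derivation.finrank_le_of_cyclic_semiconj (k := k) hp
    (fun i => (XmatL k d f i).map ρ) (fun i => (YmatL k d f i).map ρ) hunit hrel
    (derivation_eq_zero_of_XmatL_YmatL k d f ρ hρ)
  rw [Fintype.card_fin] at this
  exact_mod_cast this

theorem relIdeal_le_ker [NeZero f] {B : Type} [CommRing B] (φ : PKLoc k d f →+* B)
    (hY : ∀ i a b, φ (YmatL k d f i a b) = 0) : relIdeal k p d f ≤ RingHom.ker φ := by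
  refine Ideal.span_le.2 ?_
  rintro _ ⟨i, a, b, rfl⟩
  rw [SetLike.mem_coe, RingHom.mem_ker, Matrix.sub_apply, map_sub, Matrix.smul_apply,
    smul_eq_mul, map_mul, Matrix.mul_apply, Matrix.mul_apply, map_sum, map_sum,
    Finset.sum_eq_zero fun c _ => by rw [map_mul, hY, mul_zero],
    Finset.sum_eq_zero fun c _ => by rw [map_mul, hY, zero_mul], mul_zero, sub_zero]

/-- The homomorphism specializing all `Y⁽ⁱ⁾` to zero. -/
theorem exists_algHom_PKLoc_fractionRing :
    ∃ φ : PKLoc k d f →ₐ[k] FractionRing (MvPolynomial (Fin f × Fin d × Fin d) k),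
      (∀ s, φ (algebraMap (PKPoly k d f) _ (MvPolynomial.X (0, s))) =
        algebraMap _ _ (MvPolynomial.X s : MvPolynomial (Fin f × Fin d × Fin d) k)) ∧
      ∀ s, φ (algebraMap (PKPoly k d f) _ (MvPolynomial.X (1, s))) = 0 := by
  let S := MvPolynomial (Fin f × Fin d × Fin d) k
  let ev : PKPoly k d f →ₐ[k] S := MvPolynomial.aeval fun s =>
    if s.1 = 0 then MvPolynomial.X s.2 else 0
  have hev : ev (detProd k d f) ≠ 0 := by
    intro h
    have h1 := congrArg (MvPolynomial.eval fun s => if s.2.1 = s.2.2 then (1 : k) else 0) h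
    rw [detProd, map_prod, map_prod, map_zero, Finset.prod_eq_zero_iff] at h1
    obtain ⟨i, -, hi⟩ := h1
    rw [AlgHom.map_det, RingHom.map_det] at hi
    have : (1 : Matrix (Fin d) (Fin d) k).det = 0 := by
      rw [← hi]
      congr 1
      ext a b
      simp [ev, Xmat, Matrix.one_apply]
    simp at this
  let F : PKPoly k d f →ₐ[k] FractionRing S := (IsScalarTower.toAlgHom k S (FractionRing S)).comp ev
  have hF : ∀ y : Submonoid.powers (detProd k d f), IsUnit (F y) := by
    rintro ⟨_, r, rfl⟩
    rw [map_pow]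
    refine IsUnit.pow r (isUnit_iff_ne_zero.2 ?_)
    exact (map_ne_zero_iff _ (IsFractionRing.injective S (FractionRing S))).2 hev
  have hlift (q : PKPoly k d f) :
      IsLocalization.liftAlgHom (S := PKLoc k d f) hF (algebraMap _ _ q) =
        algebraMap S _ (ev q) := IsLocalization.lift_eq _ _
  refine ⟨IsLocalization.liftAlgHom (S := PKLoc k d f) hF, fun s => ?_, fun s => ?_⟩ <;>
    rw [hlift] <;> simp [ev, S]

theorem le_ringKrullDim_quotient_relIdeal [NeZero f] :
    ((f * d ^ 2 : ℕ) : WithBot ℕ∞) ≤ ringKrullDim (PKLoc k d f ⧸ relIdeal k p d f) := by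
  obtain ⟨φ, hφX, hφY⟩ := exists_algHom_PKLoc_fractionRing k d f
  have hsurj := φ.rangeRestrict_surjective
  have : Algebra.FiniteType k φ.range := Algebra.FiniteType.of_surjective φ.rangeRestrict hsurj
  let v : Fin f × Fin d × Fin d → φ.range := fun s =>
    φ.rangeRestrict (algebraMap (PKPoly k d f) _ (MvPolynomial.X (0, s)))
  have hv : AlgebraicIndependent k v := by
    refine AlgebraicIndependent.of_comp φ.range.val ?_
    have hcomp : φ.range.val ∘ v = IsScalarTower.toAlgHom k (MvPolynomial (Fin f × Fin d × Fin d) k) _ ∘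
        MvPolynomial.X :=
      funext hφX
    rw [hcomp]
    exact (MvPolynomial.algebraicIndependent_X _ k).map' (IsFractionRing.injective _ _)
  have hle : relIdeal k p d f ≤ RingHom.ker φ.rangeRestrict.toRingHom :=
    relIdeal_le_ker k p d f _ fun i a b => Subtype.ext (hφY (i, a, b))
  have hdim : ringKrullDim φ.range ≤ ringKrullDim (PKLoc k d f ⧸ relIdeal k p d f) :=
    ringKrullDim_le_of_surjective (Ideal.Quotient.lift _ _ hle)
      (Ideal.Quotient.lift_surjective_of_surjective _ hle hsurj)
  refine le_trans ?_ (hv.card_le_ringKrullDim.trans hdim)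
  simp [sq]

/-- **Theorem 3.2 (ThmReduced), dimension.** The coordinate ring `A/I` of the scheme
`P_{K₀,d}` (base changed to a characteristic-zero field `k`) has Krull dimension `f·d²`. -/
theorem statement1 [CharZero k] [NeZero f] (hp : p.Prime) (hd : 1 ≤ d) :
    ringKrullDim (PKLoc k d f ⧸ relIdeal k p d f) = ((f * d ^ 2 : ℕ) : WithBot ℕ∞) := by
  refine le_antisymm (ringKrullDim_quotient_le_of_forall_prime _ _ fun P hP hle => ?_)
    (le_ringKrullDim_quotient_relIdeal k p d f)
  exact ringKrullDim_le_of_relIdeal_le_ker k p d f hp.one_lt (Ideal.Quotient.mkₐ k P)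
    (Ideal.Quotient.mkₐ_surjective k P) (hle.trans_eq (Ideal.Quotient.mkₐ_ker k P).symm)
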